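/- Assume Condition 1. Then there exists an optimal feasible utility function u whose payment function t(z) = ∂₁u(z)·z₁ + ∂₂u(z)·z₂ − u(z) is weakly increasing in each coordinate: for any points (x,y), (x',y') ∈ V at which u is differentiable, if x ≤ x' and y = y', or if x = x' and y ≤ y', then t(x,y) ≤ t(x',y'). -/

import Mathlib

open MeasureTheory Set

noncomputable section

/-- A positive, bounded, differentiable density on `[a,b]` integrating to 1. -/
def Density (a b : ℝ) (h : ℝ → ℝ) : Prop :=
  (∀ x ∈ Set.Icc a b, 0 < h x) ∧ (∃ M, ∀ x ∈ Set.Icc a b, h x ≤ M) ∧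
  (∀ x ∈ Set.Icc a b, DifferentiableAt ℝ h x) ∧ (∫ x in a..b, h x) = 1

/-- The valuation rectangle `V = [xA,xB] × [yA,yC]`. -/
def V (xA xB yA yC : ℝ) : Set (ℝ × ℝ) := Set.Icc (xA, yA) (xB, yC)

/-- First partial derivative. -/
def pd1 (u : ℝ × ℝ → ℝ) (z : ℝ × ℝ) : ℝ := fderiv ℝ u z (1, 0)

/-- Second partial derivative. -/
def pd2 (u : ℝ × ℝ → ℝ) (z : ℝ × ℝ) : ℝ := fderiv ℝ u z (0, 1)

/-- A feasible buyer utility function: nonnegative, convex, with increments in each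
coordinate between `0` and the coordinate increment (partial derivatives in `[0,1]`). -/
def Feasible (xA xB yA yC : ℝ) (u : ℝ × ℝ → ℝ) : Prop :=
  (∀ z ∈ V xA xB yA yC, 0 ≤ u z) ∧
  ConvexOn ℝ (V xA xB yA yC) u ∧
  (∀ x x' y, xA ≤ x → x ≤ x' → x' ≤ xB → y ∈ Set.Icc yA yC →
    0 ≤ u (x', y) - u (x, y) ∧ u (x', y) - u (x, y) ≤ x' - x) ∧
  (∀ x y y', x ∈ Set.Icc xA xB → yA ≤ y → y ≤ y' → y' ≤ yC →
    0 ≤ u (x, y') - u (x, y) ∧ u (x, y') - u (x, y) ≤ y' - y)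

/-- The seller's expected revenue from utility function `u` under joint density
`f₁(x)·f₂(y)`. -/
def Rev (xA xB yA yC : ℝ) (f1 f2 : ℝ → ℝ) (u : ℝ × ℝ → ℝ) : ℝ :=
  ∫ z in V xA xB yA yC, (z.1 * pd1 u z + z.2 * pd2 u z - u z) * (f1 z.1 * f2 z.2)

/-- The optimal revenue: supremum of revenue over feasible utility functions. -/
def OptRev (xA xB yA yC : ℝ) (f1 f2 : ℝ → ℝ) : ℝ :=
  sSup {r | ∃ u, Feasible xA xB yA yC u ∧ r = Rev xA xB yA yC f1 f2 u}

/-- A feasible utility function is optimal if its revenue attains the supremum. -/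
def Optimal (xA xB yA yC : ℝ) (f1 f2 : ℝ → ℝ) (u : ℝ × ℝ → ℝ) : Prop :=
  Feasible xA xB yA yC u ∧ Rev xA xB yA yC f1 f2 u = OptRev xA xB yA yC f1 f2

/-- The power rate of a density `h`: `PR(h)(x) = x·h'(x)/h(x)`. -/
def PR (h : ℝ → ℝ) (x : ℝ) : ℝ := x * deriv h x / h x

/-- The bundling revenue `BRev = sup_{p ≥ 0} p · ∫_{x+y ≥ p} f`. -/
def BRev (xA xB yA yC : ℝ) (f1 f2 : ℝ → ℝ) : ℝ :=
  sSup {r | ∃ p, 0 ≤ p ∧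
    r = p * ∫ z in {z ∈ V xA xB yA yC | p ≤ z.1 + z.2}, f1 z.1 * f2 z.2}

/-- The payment associated with utility `u` at a point of differentiability. -/
def pay (u : ℝ × ℝ → ℝ) (z : ℝ × ℝ) : ℝ := pd1 u z * z.1 + pd2 u z * z.2 - u z

open Filter Topology
open scoped NNReal

section Preliminaries

variable {xA xB yA yC : ℝ} {u F : ℝ × ℝ → ℝ} {K : ℝ≥0}

lemma mem_V {z : ℝ × ℝ} :
    z ∈ V xA xB yA yC ↔ (xA ≤ z.1 ∧ yA ≤ z.2) ∧ z.1 ≤ xB ∧ z.2 ≤ yC := Iff.rfl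

lemma convex_V : Convex ℝ (V xA xB yA yC) := convex_Icc _ _

lemma isCompact_V : IsCompact (V xA xB yA yC) := isCompact_Icc

lemma measurableSet_V : MeasurableSet (V xA xB yA yC) := measurableSet_Icc

lemma interior_V : interior (V xA xB yA yC) = Ioo xA xB ×ˢ Ioo yA yC := by
  rw [V, ← Icc_prod_Icc, interior_prod_eq, interior_Icc, interior_Icc]

lemma closure_interior_V (h1 : xA < xB) (h3 : yA < yC) :
    closure (interior (V xA xB yA yC)) = V xA xB yA yC := by
  rw [interior_V, closure_prod_eq, closure_Ioo h1.ne, closure_Ioo h3.ne, Icc_prod_Icc, V]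

lemma ae_mem_interior_V :
    ∀ᵐ z ∂volume.restrict (V xA xB yA yC), z ∈ interior (V xA xB yA yC) := by
  have hf : ∀ᵐ z : ℝ × ℝ, z ∉ frontier (V xA xB yA yC) :=
    measure_eq_zero_iff_ae_notMem.1 (convex_V.addHaar_frontier volume)
  rw [ae_restrict_iff' measurableSet_V]
  filter_upwards [hf] with z hz hV
  by_contra h
  exact hz ⟨subset_closure hV, h⟩

lemma ae_differentiableAt_V (hu : LipschitzOnWith K u (V xA xB yA yC)) :
    ∀ᵐ z ∂volume.restrict (V xA xB yA yC), DifferentiableAt ℝ u z := by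
  filter_upwards [hu.ae_differentiableWithinAt measurableSet_V (μ := volume), ae_mem_interior_V]
    with z hz hi
  exact hz.differentiableAt (mem_interior_iff_mem_nhds.1 hi)

lemma abs_fderiv_self_le (hu : LipschitzOnWith K u (V xA xB yA yC)) {z : ℝ × ℝ}
    (hz : z ∈ interior (V xA xB yA yC)) : |fderiv ℝ u z z| ≤ K * ‖z‖ := by
  have h := norm_fderiv_le_of_lipschitzOn ℝ (mem_interior_iff_mem_nhds.1 hz) hu
  exact ((fderiv ℝ u z).le_opNorm z).trans (by gcongr)

lemma exists_norm_le_V : ∃ C : ℝ, 0 ≤ C ∧ ∀ z ∈ V xA xB yA yC, ‖z‖ ≤ C := by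
  obtain ⟨C, hC⟩ :=
    (isCompact_V (xA := xA) (xB := xB) (yA := yA) (yC := yC)).isBounded.exists_norm_le
  exact ⟨max C 0, le_max_right _ _, fun z hz ↦ (hC z hz).trans (le_max_left _ _)⟩

lemma exists_abs_le_V (hu : LipschitzOnWith K u (V xA xB yA yC)) :
    ∃ C : ℝ, ∀ z ∈ V xA xB yA yC, |u z| ≤ C :=
  isCompact_V.exists_bound_of_continuousOn hu.continuousOn

lemma fderiv_apply_eq (u : ℝ × ℝ → ℝ) (z d : ℝ × ℝ) :
    fderiv ℝ u z d = pd1 u z * d.1 + pd2 u z * d.2 := by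
  have : d = d.1 • ((1, 0) : ℝ × ℝ) + d.2 • ((0, 1) : ℝ × ℝ) := by ext <;> simp
  conv_lhs => rw [this]
  simp only [map_add, map_smul, smul_eq_mul, pd1, pd2]
  ring

lemma pd_eq (u : ℝ × ℝ → ℝ) (z : ℝ × ℝ) : z.1 * pd1 u z + z.2 * pd2 u z = fderiv ℝ u z z := by
  rw [fderiv_apply_eq, mul_comm, mul_comm z.2]

/-- The payment extracted by `u` at `z`, written through the radial derivative. -/
def radialPay (u : ℝ × ℝ → ℝ) (z : ℝ × ℝ) : ℝ := fderiv ℝ u z z - u z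

lemma rev_eq_radialPay (f1 f2 : ℝ → ℝ) (u : ℝ × ℝ → ℝ) : Rev xA xB yA yC f1 f2 u =
    ∫ z in V xA xB yA yC, radialPay u z * (f1 z.1 * f2 z.2) := by
  simp only [Rev, pd_eq, radialPay]

lemma measurable_fderiv_self (u : ℝ × ℝ → ℝ) : Measurable fun z ↦ fderiv ℝ u z z := by
  simp_rw [fderiv_apply_eq u _ _]
  exact ((measurable_fderiv_apply_const ℝ u _).mul measurable_fst).add
    ((measurable_fderiv_apply_const ℝ u _).mul measurable_snd)

lemma aestronglyMeasurable_radialPay (hu : LipschitzOnWith K u (V xA xB yA yC)) :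
    AEStronglyMeasurable (radialPay u) (volume.restrict (V xA xB yA yC)) :=
  (measurable_fderiv_self u).aestronglyMeasurable.sub
    (hu.continuousOn.aestronglyMeasurable measurableSet_V)

lemma integrableOn_radialPay_mul (hu : LipschitzOnWith K u (V xA xB yA yC))
    (hF : IntegrableOn F (V xA xB yA yC)) :
    IntegrableOn (fun z ↦ radialPay u z * F z) (V xA xB yA yC) := by
  obtain ⟨C, hC0, hC⟩ := exists_norm_le_V (xA := xA) (xB := xB) (yA := yA) (yC := yC)
  obtain ⟨B, hB⟩ := exists_abs_le_V hu
  refine Integrable.bdd_mul (c := K * C + B) hF (aestronglyMeasurable_radialPay hu) ?_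
  filter_upwards [ae_mem_interior_V] with z hz
  have hzV := interior_subset hz
  have h1 := abs_fderiv_self_le hu hz
  have h2 : K * ‖z‖ ≤ K * C := by gcongr; exact hC z hzV
  have h3 := abs_sub (fderiv ℝ u z z) (u z)
  rw [radialPay, Real.norm_eq_abs]
  linarith [hB z hzV]

lemma ConvexOn.fderiv_apply_sub_le {E : Type*} [NormedAddCommGroup E] [NormedSpace ℝ E]
    {s : Set E} {u : E → ℝ} (hu : ConvexOn ℝ s u) {z w : E} (hz : z ∈ s) (hw : w ∈ s)
    (hd : DifferentiableAt ℝ u z) : fderiv ℝ u z (w - z) ≤ u w - u z := by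
  have hc : ConvexOn ℝ (Icc (0 : ℝ) 1) (u ∘ AffineMap.lineMap z w) := by
    refine (hu.comp_affineMap (AffineMap.lineMap (k := ℝ) z w)).subset ?_ (convex_Icc 0 1)
    intro t ht
    exact hu.1.lineMap_mem hz hw ht
  have hd' : HasDerivAt (u ∘ AffineMap.lineMap (k := ℝ) z w) (fderiv ℝ u z (w - z)) 0 := by
    have h0 : HasDerivAt (AffineMap.lineMap (k := ℝ) z w) (w - z) (0 : ℝ) :=
      AffineMap.hasDerivAt_lineMap
    refine HasFDerivAt.comp_hasDerivAt (0 : ℝ) ?_ h0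
    simpa using hd.hasFDerivAt
  have := hc.le_slope_of_hasDerivAt (by simp) (by simp : (1 : ℝ) ∈ Icc (0 : ℝ) 1) zero_lt_one hd'
  simpa [slope_def_field] using this

lemma Feasible.lipschitzOnWith (hu : Feasible xA xB yA yC u) :
    LipschitzOnWith 2 u (V xA xB yA yC) := by
  refine LipschitzOnWith.of_le_add_mul _ fun z hz w hw ↦ ?_
  rw [mem_V] at hz hw
  obtain ⟨-, -, hx, hy⟩ := hu
  have hA : u (z.1, z.2) - u (w.1, z.2) ≤ |z.1 - w.1| := by
    rcases le_total z.1 w.1 with h | h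
    · linarith [(hx z.1 w.1 z.2 hz.1.1 h hw.2.1 ⟨hz.1.2, hz.2.2⟩).1, abs_nonneg (z.1 - w.1)]
    · linarith [(hx w.1 z.1 z.2 hw.1.1 h hz.2.1 ⟨hz.1.2, hz.2.2⟩).2, le_abs_self (z.1 - w.1)]
  have hB : u (w.1, z.2) - u (w.1, w.2) ≤ |z.2 - w.2| := by
    rcases le_total z.2 w.2 with h | h
    · linarith [(hy w.1 z.2 w.2 ⟨hw.1.1, hw.2.1⟩ hz.1.2 h hw.2.2).1, abs_nonneg (z.2 - w.2)]
    · linarith [(hy w.1 w.2 z.2 ⟨hw.1.1, hw.2.1⟩ hw.1.2 h hz.2.2).2, le_abs_self (z.2 - w.2)]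
  have h1 : |z.1 - w.1| ≤ dist z w := by
    rw [Prod.dist_eq, ← Real.dist_eq]; exact le_max_left _ _
  have h2 : |z.2 - w.2| ≤ dist z w := by
    rw [Prod.dist_eq, ← Real.dist_eq]; exact le_max_right _ _
  have : ((2 : ℝ≥0) : ℝ) = 2 := rfl
  rw [this]
  simp only [Prod.mk.eta] at hA hB
  linarith

end Preliminaries

section Existence

variable {xA xB yA yC : ℝ} {f1 f2 : ℝ → ℝ}

lemma Density.continuousOn {a b : ℝ} {h : ℝ → ℝ} (hh : Density a b h) : ContinuousOn h (Icc a b) :=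
  fun x hx ↦ (hh.2.2.1 x hx).continuousAt.continuousWithinAt

lemma continuousOn_density_mul (hf1 : Density xA xB f1) (hf2 : Density yA yC f2) :
    ContinuousOn (fun z : ℝ × ℝ ↦ f1 z.1 * f2 z.2) (V xA xB yA yC) :=
  (hf1.continuousOn.comp continuousOn_fst fun _ hz ↦ ⟨hz.1.1, hz.2.1⟩).mul
    (hf2.continuousOn.comp continuousOn_snd fun _ hz ↦ ⟨hz.1.2, hz.2.2⟩)

lemma integrableOn_density_mul (hf1 : Density xA xB f1) (hf2 : Density yA yC f2) :
    IntegrableOn (fun z : ℝ × ℝ ↦ f1 z.1 * f2 z.2) (V xA xB yA yC) :=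
  (continuousOn_density_mul hf1 hf2).integrableOn_compact isCompact_V

lemma density_mul_pos (hf1 : Density xA xB f1) (hf2 : Density yA yC f2) {z : ℝ × ℝ}
    (hz : z ∈ V xA xB yA yC) : 0 < f1 z.1 * f2 z.2 :=
  mul_pos (hf1.1 _ ⟨hz.1.1, hz.2.1⟩) (hf2.1 _ ⟨hz.1.2, hz.2.2⟩)

/-- Directional derivatives of convex functions converge along pointwise limits. -/
lemma tendsto_fderiv_apply_of_convexOn {E : Type*} [NormedAddCommGroup E] [NormedSpace ℝ E]
    {s : Set E} {u : ℕ → E → ℝ} {v : E → ℝ} (hu : ∀ n, ConvexOn ℝ s (u n))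
    (hlim : ∀ w ∈ s, Tendsto (fun n ↦ u n w) atTop (𝓝 (v w))) {z : E} (hz : s ∈ 𝓝 z)
    (hud : ∀ n, DifferentiableAt ℝ (u n) z) (hvd : DifferentiableAt ℝ v z) (d : E) :
    Tendsto (fun n ↦ fderiv ℝ (u n) z d) atTop (𝓝 (fderiv ℝ v z d)) := by
  have upper (d : E) {c : ℝ} (hc : fderiv ℝ v z d < c) :
      ∀ᶠ n in atTop, fderiv ℝ (u n) z d < c := by
    have hline : HasDerivAt (fun t : ℝ ↦ v (z + t • d)) (fderiv ℝ v z d) 0 :=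
      hvd.hasFDerivAt.hasLineDerivAt d
    have hslope := (hasDerivWithinAt_iff_tendsto_slope' (s := Ioi 0) (by simp)).1
      hline.hasDerivWithinAt
    have hmem : ∀ᶠ t : ℝ in 𝓝[>] 0, z + t • d ∈ s := by
      have : Tendsto (fun t : ℝ ↦ z + t • d) (𝓝 0) (𝓝 z) := by
        have : Continuous fun t : ℝ ↦ z + t • d := by fun_prop
        simpa using this.tendsto 0
      exact nhdsWithin_le_nhds (this hz)
    obtain ⟨t, ht, hts, ht0⟩ := ((hslope.eventually_lt_const hc).and
      (hmem.and self_mem_nhdsWithin)).exists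
    simp only [slope_def_field, zero_smul, add_zero, sub_zero] at ht
    have hq : Tendsto (fun n ↦ (u n (z + t • d) - u n z) / t) atTop
        (𝓝 ((v (z + t • d) - v z) / t)) :=
      ((hlim _ hts).sub (hlim _ (mem_of_mem_nhds hz))).div_const t
    filter_upwards [hq.eventually_lt_const ht] with n hn
    refine lt_of_le_of_lt ?_ hn
    rw [le_div_iff₀ ht0]
    have := (hu n).fderiv_apply_sub_le (mem_of_mem_nhds hz) hts (hud n)
    simp only [add_sub_cancel_left, map_smul, smul_eq_mul] at this
    linarith
  refine tendsto_order.2 ⟨fun c hc ↦ ?_, fun c hc ↦ upper d hc⟩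
  filter_upwards [upper (-d) (c := -c) (by simpa using hc)] with n hn
  simpa using hn

lemma tendsto_rev (hf1 : Density xA xB f1) (hf2 : Density yA yC f2) {u : ℕ → ℝ × ℝ → ℝ}
    {v : ℝ × ℝ → ℝ} (hu : ∀ n, Feasible xA xB yA yC (u n)) (hv : Feasible xA xB yA yC v)
    {B : ℝ} (hB : ∀ n, ∀ z ∈ V xA xB yA yC, |u n z| ≤ B)
    (hlim : ∀ z ∈ V xA xB yA yC, Tendsto (fun n ↦ u n z) atTop (𝓝 (v z))) :
    Tendsto (fun n ↦ Rev xA xB yA yC f1 f2 (u n)) atTop (𝓝 (Rev xA xB yA yC f1 f2 v)) := by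
  simp_rw [rev_eq_radialPay]
  obtain ⟨C, hC0, hC⟩ := exists_norm_le_V (xA := xA) (xB := xB) (yA := yA) (yC := yC)
  have hF := integrableOn_density_mul hf1 hf2
  refine tendsto_integral_of_dominated_convergence
    (fun z ↦ (2 * C + B) * (f1 z.1 * f2 z.2)) (fun n ↦ ?_) (hF.const_mul _) (fun n ↦ ?_) ?_
  · exact (integrableOn_radialPay_mul (hu n).lipschitzOnWith hF).aestronglyMeasurable
  · filter_upwards [ae_mem_interior_V] with z hz
    have hzV := interior_subset hz
    have h1 := abs_fderiv_self_le (hu n).lipschitzOnWith hz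
    have h2 : ((2 : ℝ≥0) : ℝ) * ‖z‖ ≤ 2 * C := by
      rw [NNReal.coe_ofNat]; gcongr; exact hC z hzV
    have h3 := abs_sub (fderiv ℝ (u n) z z) (u n z)
    rw [norm_mul, Real.norm_of_nonneg (density_mul_pos hf1 hf2 hzV).le, radialPay,
      Real.norm_eq_abs]
    gcongr
    · exact (density_mul_pos hf1 hf2 hzV).le
    · linarith [hB n z hzV]
  · filter_upwards [ae_mem_interior_V, ae_differentiableAt_V hv.lipschitzOnWith,
      ae_all_iff.2 fun n ↦ ae_differentiableAt_V (hu n).lipschitzOnWith] with z hz hvd hud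
    exact ((tendsto_fderiv_apply_of_convexOn (fun n ↦ (hu n).2.1) hlim
      (mem_interior_iff_mem_nhds.1 hz) hud hvd z).sub (hlim z (interior_subset hz))).mul_const _

lemma Feasible.of_tendsto {u : ℕ → ℝ × ℝ → ℝ} {v : ℝ × ℝ → ℝ}
    (hu : ∀ n, Feasible xA xB yA yC (u n))
    (hlim : ∀ z ∈ V xA xB yA yC, Tendsto (fun n ↦ u n z) atTop (𝓝 (v z))) :
    Feasible xA xB yA yC v := by
  refine ⟨fun z hz ↦ ge_of_tendsto' (hlim z hz) fun n ↦ (hu n).1 z hz,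
    ⟨convex_V, fun z hz w hw a b ha hb hab ↦ ?_⟩, fun x x' y hx hxx hx' hy ↦ ?_,
    fun x y y' hx hy hyy hy' ↦ ?_⟩
  · exact le_of_tendsto_of_tendsto' (hlim _ (convex_V hz hw ha hb hab))
      (((hlim z hz).const_smul a).add ((hlim w hw).const_smul b))
      fun n ↦ (hu n).2.1.2 hz hw ha hb hab
  · have h := (hlim (x', y) ⟨⟨hx.trans hxx, hy.1⟩, hx', hy.2⟩).sub
      (hlim (x, y) ⟨⟨hx, hy.1⟩, hxx.trans hx', hy.2⟩)
    exact ⟨ge_of_tendsto' h fun n ↦ ((hu n).2.2.1 x x' y hx hxx hx' hy).1,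
      le_of_tendsto' h fun n ↦ ((hu n).2.2.1 x x' y hx hxx hx' hy).2⟩
  · have h := (hlim (x, y') ⟨⟨hx.1, hy.trans hyy⟩, hx.2, hy'⟩).sub
      (hlim (x, y) ⟨⟨hx.1, hy⟩, hx.2, hyy.trans hy'⟩)
    exact ⟨ge_of_tendsto' h fun n ↦ ((hu n).2.2.2 x y y' hx hy hyy hy').1,
      le_of_tendsto' h fun n ↦ ((hu n).2.2.2 x y y' hx hy hyy hy').2⟩

lemma Feasible.congr {u v : ℝ × ℝ → ℝ} (hu : Feasible xA xB yA yC u)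
    (huv : EqOn u v (V xA xB yA yC)) : Feasible xA xB yA yC v :=
  .of_tendsto (fun _ ↦ hu) fun z hz ↦ by rw [huv hz]; exact tendsto_const_nhds

lemma rev_congr {u v : ℝ × ℝ → ℝ} (huv : EqOn u v (V xA xB yA yC)) :
    Rev xA xB yA yC f1 f2 u = Rev xA xB yA yC f1 f2 v := by
  simp_rw [rev_eq_radialPay]
  refine integral_congr_ae ?_
  filter_upwards [ae_mem_interior_V] with z hz
  have : u =ᶠ[𝓝 z] v := huv.eventuallyEq_of_mem (mem_interior_iff_mem_nhds.1 hz)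
  rw [radialPay, radialPay, this.fderiv_eq, this.eq_of_nhds]

lemma Feasible.corner_le {u : ℝ × ℝ → ℝ} (hu : Feasible xA xB yA yC u) {z : ℝ × ℝ}
    (hz : z ∈ V xA xB yA yC) :
    u (xA, yA) ≤ u z ∧ u z ≤ u (xA, yA) + ((xB - xA) + (yC - yA)) := by
  obtain ⟨-, -, hx, hy⟩ := hu
  rw [mem_V] at hz
  have h1 := hx xA z.1 z.2 le_rfl hz.1.1 hz.2.1 ⟨hz.1.2, hz.2.2⟩
  have h2 := hy xA yA z.2 ⟨le_rfl, hz.1.1.trans hz.2.1⟩ le_rfl hz.1.2 hz.2.2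
  simp only [Prod.mk.eta] at h1
  constructor <;> linarith

lemma Feasible.sub_corner {u : ℝ × ℝ → ℝ} (hu : Feasible xA xB yA yC u) :
    Feasible xA xB yA yC (fun z ↦ u z - u (xA, yA)) := by
  refine ⟨fun z hz ↦ sub_nonneg.2 (hu.corner_le hz).1, ?_, fun x x' y hx hxx hx' hy ↦ ?_,
    fun x y y' hx hy hyy hy' ↦ ?_⟩
  · simp only [sub_eq_add_neg]
    exact hu.2.1.add_const (-u (xA, yA))
  · simpa using hu.2.2.1 x x' y hx hxx hx' hy
  · simpa using hu.2.2.2 x y y' hx hy hyy hy'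

lemma rev_le_rev_sub_corner (hf1 : Density xA xB f1) (hf2 : Density yA yC f2) (h1 : xA ≤ xB)
    (h3 : yA ≤ yC) {u : ℝ × ℝ → ℝ} (hu : Feasible xA xB yA yC u) :
    Rev xA xB yA yC f1 f2 u ≤ Rev xA xB yA yC f1 f2 (fun z ↦ u z - u (xA, yA)) := by
  simp_rw [rev_eq_radialPay]
  have hF := integrableOn_density_mul hf1 hf2
  refine setIntegral_mono_on (integrableOn_radialPay_mul hu.lipschitzOnWith hF)
    (integrableOn_radialPay_mul hu.sub_corner.lipschitzOnWith hF) measurableSet_V fun z hz ↦ ?_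
  refine mul_le_mul_of_nonneg_right ?_ (density_mul_pos hf1 hf2 hz).le
  rw [radialPay, radialPay, fderiv_sub_const]
  linarith [hu.1 (xA, yA) ⟨le_rfl, h1, h3⟩]

lemma bddAbove_rev (hf1 : Density xA xB f1) (hf2 : Density yA yC f2) :
    BddAbove {r | ∃ u, Feasible xA xB yA yC u ∧ r = Rev xA xB yA yC f1 f2 u} := by
  obtain ⟨C, hC0, hC⟩ := exists_norm_le_V (xA := xA) (xB := xB) (yA := yA) (yC := yC)
  have hF := integrableOn_density_mul hf1 hf2
  refine ⟨∫ z in V xA xB yA yC, (2 * C) * (f1 z.1 * f2 z.2), ?_⟩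
  rintro _ ⟨u, hu, rfl⟩
  rw [rev_eq_radialPay]
  refine setIntegral_mono_ae_restrict (integrableOn_radialPay_mul hu.lipschitzOnWith hF)
    (hF.const_mul _) ?_
  filter_upwards [ae_mem_interior_V] with z hz
  have hzV := interior_subset hz
  refine mul_le_mul_of_nonneg_right ?_ (density_mul_pos hf1 hf2 hzV).le
  have h1 := (le_abs_self _).trans (abs_fderiv_self_le hu.lipschitzOnWith hz)
  have h2 : ((2 : ℝ≥0) : ℝ) * ‖z‖ ≤ 2 * C := by
    rw [NNReal.coe_ofNat]; gcongr; exact hC z hzV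
  rw [radialPay]
  linarith [hu.1 z hzV]

lemma feasible_zero : Feasible xA xB yA yC (fun _ ↦ 0) :=
  ⟨fun _ _ ↦ le_rfl, convexOn_const _ convex_V, fun _ _ _ _ h _ _ ↦ by simpa using h,
    fun _ _ _ _ _ h _ ↦ by simpa using h⟩

lemma Feasible.rev_le_optRev (hf1 : Density xA xB f1) (hf2 : Density yA yC f2)
    {u : ℝ × ℝ → ℝ} (hu : Feasible xA xB yA yC u) :
    Rev xA xB yA yC f1 f2 u ≤ OptRev xA xB yA yC f1 f2 :=
  le_csSup (bddAbove_rev hf1 hf2) ⟨u, hu, rfl⟩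

/-- Extension by zero of a function on `V`. -/
def extendV (φ : V xA xB yA yC → ℝ) (z : ℝ × ℝ) : ℝ :=
  open Classical in if h : z ∈ V xA xB yA yC then φ ⟨z, h⟩ else 0

lemma extendV_of_mem (φ : V xA xB yA yC → ℝ) {z : ℝ × ℝ} (hz : z ∈ V xA xB yA yC) :
    extendV φ z = φ ⟨z, hz⟩ := dif_pos hz

instance : CompactSpace (V xA xB yA yC) := isCompact_iff_compactSpace.1 isCompact_V

/-- The feasible utilities vanishing at the lower-left corner are compact for uniform
convergence. -/
lemma isCompact_feasible : IsCompact {φ : BoundedContinuousFunction (V xA xB yA yC) ℝ |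
    Feasible xA xB yA yC (extendV φ) ∧ extendV φ (xA, yA) = 0} := by
  refine BoundedContinuousFunction.arzela_ascoli₂ (Icc 0 ((xB - xA) + (yC - yA))) isCompact_Icc _
    ?_ (fun φ z hφ ↦ ?_) ?_
  · refine IsSeqClosed.isClosed fun φ ψ hφ hlim ↦ ?_
    have hp (z : ℝ × ℝ) : Tendsto (fun n ↦ extendV (φ n) z) atTop (𝓝 (extendV ψ z)) := by
      by_cases hz : z ∈ V xA xB yA yC
      · simp only [extendV_of_mem _ hz]
        exact (BoundedContinuousFunction.tendsto_iff_tendstoUniformly.1 hlim).tendsto_at _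
      · simp only [extendV, dif_neg hz]
        exact tendsto_const_nhds
    exact ⟨.of_tendsto (fun n ↦ (hφ n).1) fun z _ ↦ hp z,
      tendsto_nhds_unique (hp _) (by simp only [(hφ _).2]; exact tendsto_const_nhds)⟩
  · have h := hφ.1.corner_le z.2
    rw [hφ.2, extendV_of_mem _ z.2, zero_add] at h
    exact h
  · refine (LipschitzWith.uniformEquicontinuous _ 2 fun φ ↦ ?_).equicontinuous
    refine LipschitzWith.of_dist_le_mul fun z w ↦ ?_
    have := φ.2.1.lipschitzOnWith.dist_le_mul z z.2 w w.2
    rwa [extendV_of_mem _ z.2, extendV_of_mem _ w.2] at this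

/-- An optimal feasible utility exists. -/
lemma exists_optimal (h1 : xA ≤ xB) (h3 : yA ≤ yC) (hf1 : Density xA xB f1)
    (hf2 : Density yA yC f2) : ∃ u, Optimal xA xB yA yC f1 f2 u := by
  have hne : {r | ∃ u, Feasible xA xB yA yC u ∧ r = Rev xA xB yA yC f1 f2 u}.Nonempty :=
    ⟨_, _, feasible_zero, rfl⟩
  obtain ⟨r, -, hr, hmem⟩ := exists_seq_tendsto_sSup hne (bddAbove_rev hf1 hf2)
  choose u hu hru using hmem
  have hcont (n : ℕ) : Continuous fun z : V xA xB yA yC ↦ u n z - u n (xA, yA) :=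
    continuousOn_iff_continuous_domRestrict.1 (hu n).sub_corner.lipschitzOnWith.continuousOn
  let φ (n : ℕ) : BoundedContinuousFunction (V xA xB yA yC) ℝ :=
    .mkOfCompact ⟨fun z ↦ u n z - u n (xA, yA), hcont n⟩
  have hφu (n : ℕ) : EqOn (fun z ↦ u n z - u n (xA, yA)) (extendV (φ n)) (V xA xB yA yC) :=
    fun z hz ↦ by rw [extendV_of_mem _ hz]; rfl
  have hcorner : (xA, yA) ∈ V xA xB yA yC := ⟨le_rfl, h1, h3⟩
  have hφ (n : ℕ) : Feasible xA xB yA yC (extendV (φ n)) ∧ extendV (φ n) (xA, yA) = 0 :=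
    ⟨(hu n).sub_corner.congr (hφu n), by rw [← hφu n hcorner]; exact sub_self _⟩
  obtain ⟨ψ, hψ, k, hk, hlim⟩ := isCompact_feasible.tendsto_subseq hφ
  refine ⟨extendV ψ, hψ.1, ?_⟩
  have hconv : Tendsto (fun n ↦ Rev xA xB yA yC f1 f2 (extendV (φ (k n)))) atTop
      (𝓝 (Rev xA xB yA yC f1 f2 (extendV ψ))) := by
    refine tendsto_rev hf1 hf2 (fun n ↦ (hφ _).1) hψ.1 (B := (xB - xA) + (yC - yA))
      (fun n z hz ↦ ?_) fun z hz ↦ ?_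
    · have h := (hφ (k n)).1.corner_le hz
      rw [(hφ (k n)).2, zero_add] at h
      rw [abs_of_nonneg h.1]
      exact h.2
    · simp only [extendV_of_mem _ hz]
      exact (BoundedContinuousFunction.tendsto_iff_tendstoUniformly.1 hlim).tendsto_at _
  refine tendsto_nhds_unique hconv (tendsto_of_tendsto_of_tendsto_of_le_of_le
    (hr.comp hk.tendsto_atTop) tendsto_const_nhds (fun n ↦ ?_)
    fun n ↦ (hφ (k n)).1.rev_le_optRev hf1 hf2)
  rw [Function.comp_apply, hru, ← rev_congr (hφu (k n))]
  exact rev_le_rev_sub_corner hf1 hf2 h1 h3 (hu _)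

end Existence

section Dominance

variable {xA xB yA yC : ℝ} {f1 f2 : ℝ → ℝ}

/-- Condition 1 makes `s ↦ s³ f(s z)` nonincreasing along rays. -/
lemma density_mul_le_of_smul (hf1 : Density xA xB f1) (hf2 : Density yA yC f2)
    (hC1 : ∀ x ∈ Icc xA xB, ∀ y ∈ Icc yA yC, PR f1 x + PR f2 y ≤ -3)
    {z : ℝ × ℝ} {s : ℝ} (hs1 : s ≤ 1) (hz : z ∈ V xA xB yA yC)
    (hsz : s • z ∈ V xA xB yA yC) :
    f1 z.1 * f2 z.2 ≤ s ^ 3 * (f1 (s • z).1 * f2 (s • z).2) := by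
  have hmem : ∀ t ∈ Icc s 1, t * z.1 ∈ Icc xA xB ∧ t * z.2 ∈ Icc yA yC := by
    intro t ht
    have : (fun r : ℝ ↦ r • z) t ∈ V xA xB yA yC := by
      have hconv : Convex ℝ ((fun r : ℝ ↦ r • z) ⁻¹' V xA xB yA yC) :=
        convex_V.is_linear_preimage (IsLinearMap.mk (fun a b ↦ add_smul a b z)
          fun a b ↦ by simp [mul_smul])
      exact hconv.ordConnected.out hsz (by simpa using hz) ht
    exact ⟨⟨this.1.1, this.2.1⟩, this.1.2, this.2.2⟩
  have hder : ∀ t ∈ Icc s 1, HasDerivAt (fun t ↦ t ^ 3 * (f1 (t * z.1) * f2 (t * z.2)))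
      (3 * t ^ 2 * (f1 (t * z.1) * f2 (t * z.2)) + t ^ 3 * ((deriv f1 (t * z.1) * z.1) *
        f2 (t * z.2) + f1 (t * z.1) * (deriv f2 (t * z.2) * z.2))) t := by
    intro t ht
    obtain ⟨h1, h2⟩ := hmem t ht
    have e1 : HasDerivAt (fun t ↦ f1 (t * z.1)) (deriv f1 (t * z.1) * z.1) t :=
      (hf1.2.2.1 _ h1).hasDerivAt.comp t (hasDerivAt_mul_const z.1)
    have e2 : HasDerivAt (fun t ↦ f2 (t * z.2)) (deriv f2 (t * z.2) * z.2) t :=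
      (hf2.2.2.1 _ h2).hasDerivAt.comp t (hasDerivAt_mul_const z.2)
    exact ((hasDerivAt_pow 3 t).mul (e1.mul e2)).congr_deriv (by simp)
  have hanti : AntitoneOn (fun t ↦ t ^ 3 * (f1 (t * z.1) * f2 (t * z.2))) (Icc s 1) := by
    refine antitoneOn_of_deriv_nonpos (convex_Icc _ _)
      (fun t ht ↦ (hder t ht).continuousAt.continuousWithinAt)
      (fun t ht ↦ (hder t (interior_subset ht)).differentiableAt.differentiableWithinAt)
      fun t ht ↦ ?_
    replace ht := interior_subset ht
    rw [(hder t ht).deriv]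
    obtain ⟨h1, h2⟩ := hmem t ht
    have p1 := hf1.1 _ h1
    have p2 := hf2.1 _ h2
    have hPR := hC1 _ h1 _ h2
    rw [PR, PR] at hPR
    calc _ = t ^ 2 * (f1 (t * z.1) * f2 (t * z.2)) * (3 + (t * z.1 * deriv f1 (t * z.1) /
          f1 (t * z.1) + t * z.2 * deriv f2 (t * z.2) / f2 (t * z.2))) := by
          field_simp
      _ ≤ 0 := mul_nonpos_of_nonneg_of_nonpos (by positivity) (by linarith)
  simpa using hanti ⟨le_rfl, hs1⟩ ⟨hs1, le_rfl⟩ hs1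

/-- Dilation quotient approximating the radial payment of `w`; the second term is dropped at
points which are not dilates of points of `V`. -/
def dilationQuotient (S : Set (ℝ × ℝ)) (w : ℝ × ℝ → ℝ) (l : ℝ) (z : ℝ × ℝ) : ℝ :=
  (w (l • z) / l - ((fun z ↦ l⁻¹ • z) ⁻¹' S).indicator w z) / (l - 1)

lemma tendsto_dilationQuotient {S : Set (ℝ × ℝ)} {w : ℝ × ℝ → ℝ} {l : ℕ → ℝ}
    (hl1 : ∀ n, 1 < l n) (hl : Tendsto l atTop (𝓝 1)) {z : ℝ × ℝ} (hz : S ∈ 𝓝 z)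
    (hw : DifferentiableAt ℝ w z) :
    Tendsto (fun n ↦ dilationQuotient S w (l n) z) atTop (𝓝 (radialPay w z)) := by
  have hd : HasDerivAt (fun t : ℝ ↦ w (t • z) / t) (radialPay w z) 1 := by
    have h0 : HasDerivAt (fun t : ℝ ↦ t • z) z 1 := by
      simpa using (hasDerivAt_id (1 : ℝ)).smul_const z
    have h1 : HasDerivAt (fun t : ℝ ↦ w (t • z)) (fderiv ℝ w z z) 1 := by
      refine HasFDerivAt.comp_hasDerivAt (1 : ℝ) ?_ h0
      simpa using hw.hasFDerivAt
    simpa [radialPay] using! h1.div (hasDerivAt_id (1 : ℝ)) one_ne_zero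
  have hl' : Tendsto l atTop (𝓝[≠] 1) :=
    tendsto_nhdsWithin_iff.2 ⟨hl, .of_forall fun n ↦ (hl1 n).ne'⟩
  refine ((hasDerivAt_iff_tendsto_slope.1 hd).comp hl').congr' ?_
  have hmem : ∀ᶠ n in atTop, (l n)⁻¹ • z ∈ S := by
    have : Tendsto (fun n ↦ (l n)⁻¹ • z) atTop (𝓝 z) := by
      simpa using (hl.inv₀ one_ne_zero).smul_const z
    exact this hz
  filter_upwards [hmem] with n hn
  rw [dilationQuotient, indicator_of_mem (by exact hn)]
  simp [slope_def_field]

lemma abs_dilationQuotient_le (h0 : 0 ≤ xA) (h2 : 0 ≤ yA) {K : ℝ≥0} {w : ℝ × ℝ → ℝ}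
    (hw : LipschitzWith K w)
    (hL : ∀ z ∈ V xA xB yA yC, z.1 = xA ∨ z.2 = yA → w z = 0) {l : ℝ} (hl : 1 < l)
    {z : ℝ × ℝ} (hz : z ∈ V xA xB yA yC) :
    |dilationQuotient (V xA xB yA yC) w l z| ≤ 2 * (K * ‖z‖) + |w z| := by
  have hl0 : 0 < l := zero_lt_one.trans hl
  have hl1 : 0 < l - 1 := sub_pos.2 hl
  have hdil : |w (l • z) - w z| ≤ K * ((l - 1) * ‖z‖) := by
    have := hw.dist_le_mul (l • z) z
    rwa [Real.dist_eq, dist_eq_norm, show l • z - z = (l - 1) • z by rw [sub_smul, one_smul],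
      norm_smul, Real.norm_of_nonneg hl1.le] at this
  have hmain : |w (l • z) / l - w z| ≤ (K * ‖z‖ + |w z|) * (l - 1) := by
    have e : w (l • z) / l - w z = ((w (l • z) - w z) - (l - 1) * w z) / l := by
      field_simp; ring
    rw [e, abs_div, abs_of_pos hl0, div_le_iff₀ hl0]
    have h := abs_sub (w (l • z) - w z) ((l - 1) * w z)
    rw [abs_mul, abs_of_pos hl1] at h
    have hnn : 0 ≤ (K * ‖z‖ + |w z|) * (l - 1) := by positivity
    nlinarith
  have hrest : |w z - ((fun z ↦ l⁻¹ • z) ⁻¹' V xA xB yA yC).indicator w z| ≤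
      K * ‖z‖ * (l - 1) := by
    by_cases hm : z ∈ (fun z ↦ l⁻¹ • z) ⁻¹' V xA xB yA yC
    · rw [indicator_of_mem hm, sub_self, abs_zero]
      positivity
    rw [indicator_of_notMem hm, sub_zero]
    have hzV := mem_V.1 hz
    have key {p : ℝ × ℝ} (hp : w p = 0) (hd : dist z p ≤ (l - 1) * ‖z‖) :
        |w z| ≤ K * ‖z‖ * (l - 1) := by
      have h := hw.dist_le_mul z p
      rw [Real.dist_eq, hp, sub_zero] at h
      calc |w z| ≤ K * dist z p := h
        _ ≤ K * ((l - 1) * ‖z‖) := by gcongr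
        _ = _ := by ring
    have hn1 : z.1 ≤ ‖z‖ := (le_abs_self _).trans (norm_fst_le z)
    have hn2 : z.2 ≤ ‖z‖ := (le_abs_self _).trans (norm_snd_le z)
    have hli : l⁻¹ ≤ 1 := inv_le_one_of_one_le₀ hl.le
    by_cases hx : l * xA ≤ z.1
    · have hy : z.2 < l * yA := by
        by_contra! hy
        refine hm (mem_V.2 ⟨⟨?_, ?_⟩, ?_, ?_⟩)
        · exact (le_inv_mul_iff₀ hl0).2 hx
        · exact (le_inv_mul_iff₀ hl0).2 hy
        · exact (mul_le_of_le_one_left (h0.trans hzV.1.1) hli).trans hzV.2.1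
        · exact (mul_le_of_le_one_left (h2.trans hzV.1.2) hli).trans hzV.2.2
      refine key (p := (z.1, yA)) (hL _ ⟨⟨hzV.1.1, le_rfl⟩, hzV.2.1, hzV.1.2.trans hzV.2.2⟩
        (.inr rfl)) ?_
      rw [Prod.dist_eq, dist_self, Real.dist_eq, abs_of_nonneg (sub_nonneg.2 hzV.1.2)]
      refine max_le (by positivity) ?_
      nlinarith [hzV.1.2]
    · push Not at hx
      refine key (p := (xA, z.2)) (hL _ ⟨⟨le_rfl, hzV.1.2⟩, hzV.1.1.trans hzV.2.1, hzV.2.2⟩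
        (.inl rfl)) ?_
      rw [Prod.dist_eq, dist_self, Real.dist_eq, abs_of_nonneg (sub_nonneg.2 hzV.1.1)]
      refine max_le ?_ (by positivity)
      nlinarith [hzV.1.1]
  rw [dilationQuotient, abs_div, abs_of_pos hl1, div_le_iff₀ hl1]
  have := abs_add_le (w (l • z) / l - w z)
    (w z - ((fun z ↦ l⁻¹ • z) ⁻¹' V xA xB yA yC).indicator w z)
  rw [sub_add_sub_cancel] at this
  linarith

lemma measurableSet_dilate (l : ℝ) : MeasurableSet ((fun z ↦ l⁻¹ • z) ⁻¹' V xA xB yA yC) :=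
  measurableSet_V.preimage (measurable_const_smul _)

lemma integral_dilationQuotient_nonneg (hf1 : Density xA xB f1) (hf2 : Density yA yC f2)
    (hC1 : ∀ x ∈ Icc xA xB, ∀ y ∈ Icc yA yC, PR f1 x + PR f2 y ≤ -3)
    {w : ℝ × ℝ → ℝ} (hw : Continuous w) (hw0 : ∀ z, 0 ≤ w z) {l : ℝ} (hl : 1 < l) :
    0 ≤ ∫ z in V xA xB yA yC,
      dilationQuotient (V xA xB yA yC) w l z * (f1 z.1 * f2 z.2) := by
  have hl0 : 0 < l := zero_lt_one.trans hl
  set F : ℝ × ℝ → ℝ := fun z ↦ f1 z.1 * f2 z.2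
  set S := V xA xB yA yC
  have hS : MeasurableSet S := measurableSet_V
  have hFc : ContinuousOn F S := continuousOn_density_mul hf1 hf2
  set T := (fun z ↦ l⁻¹ • z) ⁻¹' S
  have hT : MeasurableSet T := measurableSet_dilate l
  let H : ℝ × ℝ → ℝ := fun z ↦ w z * S.indicator F (l⁻¹ • z)
  have hHint : Integrable fun z ↦ H (l • z) := by
    have : (fun z ↦ H (l • z)) = S.indicator fun z ↦ w (l • z) * F z := by
      funext z
      simp only [H, inv_smul_smul₀ hl0.ne']
      by_cases hz : z ∈ S <;> simp [hz]
    rw [this, integrable_indicator_iff hS]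
    exact ((hw.comp (continuous_const_smul l)).continuousOn.mul hFc).integrableOn_compact
      isCompact_V
  have hHint' : Integrable H := (integrable_comp_smul_iff volume H hl0.ne').1 hHint
  have hint1 : IntegrableOn (fun z ↦ w (l • z) * F z) S :=
    ((hw.comp (continuous_const_smul l)).continuousOn.mul hFc).integrableOn_compact isCompact_V
  have hint2 : IntegrableOn (fun z ↦ T.indicator (fun z ↦ w z * F z) z) S :=
    ((hw.continuousOn.mul hFc).integrableOn_compact isCompact_V).indicator hT
  have hchange : ∫ z in S, w (l • z) * F z = l⁻¹ ^ 2 * ∫ z, H z := by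
    have := Measure.integral_comp_smul (volume : Measure (ℝ × ℝ)) H l
    rw [abs_of_pos (by positivity), Module.finrank_prod, Module.finrank_self, smul_eq_mul] at this
    rw [inv_pow, ← this, ← integral_indicator hS]
    refine integral_congr_ae (.of_forall fun z ↦ ?_)
    simp only [H, inv_smul_smul₀ hl0.ne']
    by_cases hz : z ∈ S <;> simp [hz]
  have hcomp : ∫ z in S, T.indicator (fun z ↦ w z * F z) z ≤ l⁻¹ ^ 3 * ∫ z, H z := by
    rw [← integral_indicator hS, ← integral_const_mul]
    refine integral_mono (hint2.integrable_indicator hS) (hHint'.const_mul _)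
      fun z ↦ ?_
    by_cases hzT : l⁻¹ • z ∈ S
    · have hzT' : z ∈ T := hzT
      by_cases hz : z ∈ S
      · simp only [H, indicator_of_mem, hz, hzT', hzT]
        have := density_mul_le_of_smul hf1 hf2 hC1
          (inv_le_one_of_one_le₀ hl.le) hz hzT
        calc w z * F z ≤ w z * (l⁻¹ ^ 3 * F (l⁻¹ • z)) := mul_le_mul_of_nonneg_left this (hw0 z)
          _ = _ := by ring
      · simp only [H, indicator_of_mem, indicator_of_notMem, hz, hzT, not_false_eq_true]
        have := (density_mul_pos hf1 hf2 hzT).le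
        exact mul_nonneg (by positivity) (mul_nonneg (hw0 z) this)
    · have hzT' : z ∉ T := hzT
      by_cases hz : z ∈ S <;>
        simp [H, hz, hzT, hzT']
  have hrw : ∀ z, dilationQuotient S w l z * F z =
      (l - 1)⁻¹ * (l⁻¹ * (w (l • z) * F z) - T.indicator (fun z ↦ w z * F z) z) := by
    intro z
    rw [dilationQuotient]
    by_cases hz : z ∈ T
    · rw [indicator_of_mem hz, indicator_of_mem hz]; ring
    · rw [indicator_of_notMem hz, indicator_of_notMem hz]; ring
  change 0 ≤ ∫ z in S, dilationQuotient S w l z * F z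
  simp_rw [hrw]
  rw [integral_const_mul, integral_sub (hint1.const_mul _) hint2, integral_const_mul, hchange]
  refine mul_nonneg (inv_nonneg.2 (sub_nonneg.2 hl.le)) (sub_nonneg.2 (hcomp.trans_eq (by ring)))

lemma integral_radialPay_nonneg (h0 : 0 ≤ xA) (h2 : 0 ≤ yA) (hf1 : Density xA xB f1)
    (hf2 : Density yA yC f2)
    (hC1 : ∀ x ∈ Icc xA xB, ∀ y ∈ Icc yA yC, PR f1 x + PR f2 y ≤ -3)
    {K : ℝ≥0} {w : ℝ × ℝ → ℝ} (hw : LipschitzWith K w) (hw0 : ∀ z, 0 ≤ w z)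
    (hL : ∀ z ∈ V xA xB yA yC, z.1 = xA ∨ z.2 = yA → w z = 0) :
    0 ≤ ∫ z in V xA xB yA yC, radialPay w z * (f1 z.1 * f2 z.2) := by
  let l (n : ℕ) : ℝ := 1 + 1 / ((n : ℝ) + 1)
  have hl1 (n : ℕ) : 1 < l n := by
    have : 0 < 1 / ((n : ℝ) + 1) := by positivity
    simp only [l]; linarith
  have hl : Tendsto l atTop (𝓝 1) := by
    simpa [l] using tendsto_one_div_add_atTop_nhds_zero_nat.const_add (1 : ℝ)
  have hF := integrableOn_density_mul hf1 hf2
  have hconv : Tendsto (fun n ↦ ∫ z in V xA xB yA yC,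
      dilationQuotient (V xA xB yA yC) w (l n) z * (f1 z.1 * f2 z.2)) atTop
      (𝓝 (∫ z in V xA xB yA yC, radialPay w z * (f1 z.1 * f2 z.2))) := by
    refine tendsto_integral_of_dominated_convergence
      (fun z ↦ (2 * (K * ‖z‖) + |w z|) * (f1 z.1 * f2 z.2)) (fun n ↦ ?_) ?_ (fun n ↦ ?_) ?_
    · refine AEStronglyMeasurable.mul (Measurable.aestronglyMeasurable ?_) hF.aestronglyMeasurable
      exact (((hw.continuous.measurable.comp (measurable_const_smul _)).div_const _).sub
        (hw.continuous.measurable.indicator (measurableSet_dilate _))).div_const _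
    · refine ContinuousOn.integrableOn_compact isCompact_V ?_
      have := hw.continuous
      exact ContinuousOn.mul (by fun_prop) (continuousOn_density_mul hf1 hf2)
    · filter_upwards [ae_restrict_mem measurableSet_V] with z hz
      have hp := (density_mul_pos hf1 hf2 hz).le
      rw [norm_mul, Real.norm_of_nonneg hp, Real.norm_eq_abs]
      exact mul_le_mul_of_nonneg_right (abs_dilationQuotient_le h0 h2 hw hL (hl1 n) hz) hp
    · filter_upwards [ae_mem_interior_V, ae_differentiableAt_V hw.lipschitzOnWith] with z hz hd
      exact (tendsto_dilationQuotient hl1 hl (mem_interior_iff_mem_nhds.1 hz) hd).mul_const _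
  exact ge_of_tendsto' hconv fun n ↦
    integral_dilationQuotient_nonneg hf1 hf2 hC1 hw.continuous hw0 (hl1 n)

/-- Raising the utility while keeping its values on the left and bottom sides raises revenue. -/
lemma rev_mono (h0 : 0 ≤ xA) (h2 : 0 ≤ yA) (hf1 : Density xA xB f1) (hf2 : Density yA yC f2)
    (hC1 : ∀ x ∈ Icc xA xB, ∀ y ∈ Icc yA yC, PR f1 x + PR f2 y ≤ -3)
    {u v : ℝ × ℝ → ℝ} (hu : Feasible xA xB yA yC u) (hv : Feasible xA xB yA yC v)
    (huv : ∀ z ∈ V xA xB yA yC, u z ≤ v z)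
    (hL : ∀ z ∈ V xA xB yA yC, z.1 = xA ∨ z.2 = yA → u z = v z) :
    Rev xA xB yA yC f1 f2 u ≤ Rev xA xB yA yC f1 f2 v := by
  obtain ⟨g, hg, hgeq⟩ := (hv.lipschitzOnWith.sub hu.lipschitzOnWith).extend_real
  have hw := lipschitzWith_one_norm.comp hg
  have heq : EqOn (v - u) (norm ∘ g) (V xA xB yA yC) := fun z hz ↦ by
    have : v z - u z = g z := hgeq hz
    rw [Function.comp_apply, ← this, Pi.sub_apply, Real.norm_of_nonneg (sub_nonneg.2 (huv z hz))]
  have hnn := integral_radialPay_nonneg h0 h2 hf1 hf2 hC1 hw (fun z ↦ norm_nonneg _)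
    fun z hz hzL ↦ by rw [← heq hz, Pi.sub_apply, hL z hz hzL, sub_self]
  have hF := integrableOn_density_mul hf1 hf2
  rw [← sub_nonneg, rev_eq_radialPay, rev_eq_radialPay, ← integral_sub
    (integrableOn_radialPay_mul hv.lipschitzOnWith hF)
    (integrableOn_radialPay_mul hu.lipschitzOnWith hF)]
  refine hnn.trans_eq (integral_congr_ae ?_)
  filter_upwards [ae_mem_interior_V, ae_differentiableAt_V hv.lipschitzOnWith,
    ae_differentiableAt_V hu.lipschitzOnWith] with z hz hdv hdu
  have he : norm ∘ g =ᶠ[𝓝 z] v - u :=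
    heq.symm.eventuallyEq_of_mem (mem_interior_iff_mem_nhds.1 hz)
  simp only [radialPay]
  rw [he.fderiv_eq, he.eq_of_nhds, fderiv_sub hdv hdu, sub_apply, Pi.sub_apply]
  ring

end Dominance

section MaximalUtility

variable {xA xB yA yC : ℝ} {u : ℝ × ℝ → ℝ}

lemma Feasible.tangent_le (hu : Feasible xA xB yA yC u) {z w : ℝ × ℝ} (hz : z ∈ V xA xB yA yC)
    (hw : w ∈ V xA xB yA yC) (hd : DifferentiableAt ℝ u z) :
    pd1 u z * (w.1 - z.1) + pd2 u z * (w.2 - z.2) ≤ u w - u z := by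
  simpa [fderiv_apply_eq] using hu.2.1.fderiv_apply_sub_le hz hw hd

lemma Feasible.pd1_mem_Icc (hu : Feasible xA xB yA yC u) {z : ℝ × ℝ}
    (hz : z ∈ interior (V xA xB yA yC)) (hd : DifferentiableAt ℝ u z) :
    pd1 u z ∈ Icc 0 1 := by
  have hzV := interior_subset hz
  rw [interior_V] at hz
  obtain ⟨⟨hx1, hx2⟩, hy1, hy2⟩ := hz
  have hA := hu.tangent_le hzV (w := (xA, z.2)) ⟨⟨le_rfl, hy1.le⟩, (hx1.trans hx2).le, hy2.le⟩ hd
  have hB := hu.tangent_le hzV (w := (xB, z.2)) ⟨⟨(hx1.trans hx2).le, hy1.le⟩, le_rfl, hy2.le⟩ hd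
  have hA' := (hu.2.2.1 xA z.1 z.2 le_rfl hx1.le hx2.le ⟨hy1.le, hy2.le⟩).1
  have hB' := (hu.2.2.1 z.1 xB z.2 hx1.le hx2.le le_rfl ⟨hy1.le, hy2.le⟩).2
  simp only [sub_self, mul_zero, add_zero, Prod.mk.eta] at hA hB hA' hB'
  constructor <;> nlinarith

lemma Feasible.pd2_mem_Icc (hu : Feasible xA xB yA yC u) {z : ℝ × ℝ}
    (hz : z ∈ interior (V xA xB yA yC)) (hd : DifferentiableAt ℝ u z) :
    pd2 u z ∈ Icc 0 1 := by
  have hzV := interior_subset hz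
  rw [interior_V] at hz
  obtain ⟨⟨hx1, hx2⟩, hy1, hy2⟩ := hz
  have hA := hu.tangent_le hzV (w := (z.1, yA)) ⟨⟨hx1.le, le_rfl⟩, hx2.le, (hy1.trans hy2).le⟩ hd
  have hB := hu.tangent_le hzV (w := (z.1, yC)) ⟨⟨hx1.le, (hy1.trans hy2).le⟩, hx2.le, le_rfl⟩ hd
  have hA' := (hu.2.2.2 z.1 yA z.2 ⟨hx1.le, hx2.le⟩ le_rfl hy1.le hy2.le).1
  have hB' := (hu.2.2.2 z.1 z.2 yC ⟨hx1.le, hx2.le⟩ hy1.le hy2.le le_rfl).2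
  simp only [sub_self, mul_zero, zero_add, Prod.mk.eta] at hA hB hA' hB'
  constructor <;> nlinarith

/-- Affine functions with slopes in `[0,1]` lying below `u` on the left and bottom sides
of `V`. -/
def sideMinorants (xA xB yA yC : ℝ) (u : ℝ × ℝ → ℝ) : Set (ℝ × ℝ → ℝ) :=
  {m | (∃ p ∈ Icc (0 : ℝ) 1, ∃ q ∈ Icc (0 : ℝ) 1, ∃ c, ∀ z, m z = p * z.1 + q * z.2 + c) ∧
    ∀ z ∈ V xA xB yA yC, z.1 = xA ∨ z.2 = yA → m z ≤ u z}

/-- The largest feasible utility with the values of `u` on the left and bottom sides of `V`.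
The negative value outside `V` makes it discontinuous at the boundary of `V`. -/
def sideHull (xA xB yA yC : ℝ) (u : ℝ × ℝ → ℝ) (z : ℝ × ℝ) : ℝ :=
  open Classical in
  if z ∈ V xA xB yA yC then sSup ((fun m ↦ m z) '' sideMinorants xA xB yA yC u) else -1

lemma zero_mem_sideMinorants (hu : Feasible xA xB yA yC u) :
    (fun _ ↦ 0) ∈ sideMinorants xA xB yA yC u :=
  ⟨⟨0, by simp, 0, by simp, 0, by simp⟩, fun z hz _ ↦ hu.1 z hz⟩

lemma sideMinorants_step {m : ℝ × ℝ → ℝ} (hm : m ∈ sideMinorants xA xB yA yC u) {z w : ℝ × ℝ}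
    (h1 : z.1 ≤ w.1) (h2 : z.2 ≤ w.2) :
    m z ≤ m w ∧ m w ≤ m z + (w.1 - z.1) + (w.2 - z.2) := by
  obtain ⟨⟨p, hp, q, hq, c, hm⟩, -⟩ := hm
  rw [hm, hm]
  constructor <;> nlinarith [hp.1, hp.2, hq.1, hq.2]

lemma bddAbove_sideMinorants {z : ℝ × ℝ} (hz : z ∈ V xA xB yA yC) :
    BddAbove ((fun m ↦ m z) '' sideMinorants xA xB yA yC u) := by
  refine ⟨u (xA, yA) + (z.1 - xA) + (z.2 - yA), ?_⟩
  rintro _ ⟨m, hm, rfl⟩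
  have hz := mem_V.1 hz
  have h := (sideMinorants_step hm (z := (xA, yA)) hz.1.1 hz.1.2).2
  have h' := hm.2 (xA, yA) ⟨le_rfl, hz.1.1.trans hz.2.1, hz.1.2.trans hz.2.2⟩ (.inl rfl)
  simp only at h ⊢
  linarith

lemma le_sideHull {m : ℝ × ℝ → ℝ} (hm : m ∈ sideMinorants xA xB yA yC u) {z : ℝ × ℝ}
    (hz : z ∈ V xA xB yA yC) : m z ≤ sideHull xA xB yA yC u z := by
  rw [sideHull, if_pos hz]
  exact le_csSup (bddAbove_sideMinorants hz) ⟨m, hm, rfl⟩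

lemma sideHull_le (hu : Feasible xA xB yA yC u) {z : ℝ × ℝ} (hz : z ∈ V xA xB yA yC) {b : ℝ}
    (hb : ∀ m ∈ sideMinorants xA xB yA yC u, m z ≤ b) : sideHull xA xB yA yC u z ≤ b := by
  rw [sideHull, if_pos hz]
  refine csSup_le ⟨_, _, zero_mem_sideMinorants hu, rfl⟩ ?_
  rintro _ ⟨m, hm, rfl⟩
  exact hb m hm

lemma feasible_sideHull (hu : Feasible xA xB yA yC u) :
    Feasible xA xB yA yC (sideHull xA xB yA yC u) := by
  refine ⟨fun z hz ↦ le_sideHull (zero_mem_sideMinorants hu) hz,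
    ⟨convex_V, fun z hz w hw a b ha hb hab ↦ ?_⟩, fun x x' y hx hxx hx' hy ↦ ?_,
    fun x y y' hx hy hyy hy' ↦ ?_⟩
  · refine sideHull_le hu (convex_V hz hw ha hb hab) fun m hm ↦ ?_
    have hmz := mul_le_mul_of_nonneg_left (le_sideHull hm hz) ha
    have hmw := mul_le_mul_of_nonneg_left (le_sideHull hm hw) hb
    obtain ⟨⟨p, -, q, -, c, hm⟩, -⟩ := hm
    calc m (a • z + b • w) = a * m z + b * m w := by
          simp only [hm, Prod.fst_add, Prod.snd_add, Prod.smul_fst, Prod.smul_snd, smul_eq_mul]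
          linear_combination -c * hab
      _ ≤ _ := add_le_add hmz hmw
  · have hz : (x, y) ∈ V xA xB yA yC := ⟨⟨hx, hy.1⟩, hxx.trans hx', hy.2⟩
    have hw : (x', y) ∈ V xA xB yA yC := ⟨⟨hx.trans hxx, hy.1⟩, hx', hy.2⟩
    refine ⟨sub_nonneg.2 (sideHull_le hu hz fun m hm ↦ ?_), sub_le_iff_le_add'.2
      (sideHull_le hu hw fun m hm ↦ ?_)⟩
    · exact (sideMinorants_step hm (z := (x, y)) (w := (x', y)) hxx le_rfl).1.trans
        (le_sideHull hm hw)
    · have h := (sideMinorants_step hm (z := (x, y)) (w := (x', y)) hxx le_rfl).2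
      have h' := le_sideHull hm hz
      simp only at h
      linarith
  · have hz : (x, y) ∈ V xA xB yA yC := ⟨⟨hx.1, hy⟩, hx.2, hyy.trans hy'⟩
    have hw : (x, y') ∈ V xA xB yA yC := ⟨⟨hx.1, hy.trans hyy⟩, hx.2, hy'⟩
    refine ⟨sub_nonneg.2 (sideHull_le hu hz fun m hm ↦ ?_), sub_le_iff_le_add'.2
      (sideHull_le hu hw fun m hm ↦ ?_)⟩
    · exact (sideMinorants_step hm (z := (x, y)) (w := (x, y')) le_rfl hyy).1.trans
        (le_sideHull hm hw)
    · have h := (sideMinorants_step hm (z := (x, y)) (w := (x, y')) le_rfl hyy).2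
      have h' := le_sideHull hm hz
      simp only at h
      linarith

/-- The tangent of `v` at `z`. -/
def tangent (v : ℝ × ℝ → ℝ) (z w : ℝ × ℝ) : ℝ :=
  v z + (pd1 v z * (w.1 - z.1) + pd2 v z * (w.2 - z.2))

lemma tangent_mem_sideMinorants {v : ℝ × ℝ → ℝ} (hv : Feasible xA xB yA yC v)
    (hvu : ∀ z ∈ V xA xB yA yC, z.1 = xA ∨ z.2 = yA → v z ≤ u z) {z : ℝ × ℝ}
    (hz : z ∈ interior (V xA xB yA yC)) (hd : DifferentiableAt ℝ v z) :
    tangent v z ∈ sideMinorants xA xB yA yC u := by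
  refine ⟨⟨_, hv.pd1_mem_Icc hz hd, _, hv.pd2_mem_Icc hz hd,
    v z - pd1 v z * z.1 - pd2 v z * z.2, fun w ↦ by rw [tangent]; ring⟩, fun w hw hL ↦ ?_⟩
  have := hv.tangent_le (interior_subset hz) hw hd
  rw [tangent]
  linarith [hvu w hw hL]

lemma sideHull_le_of_side (hu : Feasible xA xB yA yC u) :
    ∀ z ∈ V xA xB yA yC, z.1 = xA ∨ z.2 = yA → sideHull xA xB yA yC u z ≤ u z :=
  fun z hz hL ↦ sideHull_le hu hz fun _ hm ↦ hm.2 z hz hL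

lemma le_sideHull_self (h1 : xA < xB) (h3 : yA < yC) (hu : Feasible xA xB yA yC u) {w : ℝ × ℝ}
    (hw : w ∈ V xA xB yA yC) : u w ≤ sideHull xA xB yA yC u w := by
  refine le_of_forall_pos_le_add fun ε hε ↦ ?_
  have hdense : Dense {z | z ∈ V xA xB yA yC → DifferentiableAt ℝ u z} :=
    Measure.dense_of_ae ((ae_restrict_iff' measurableSet_V).1
      (ae_differentiableAt_V hu.lipschitzOnWith))
  have hne : (Metric.ball w (ε / 4) ∩ interior (V xA xB yA yC)).Nonempty :=
    mem_closure_iff.1 (by rwa [closure_interior_V h1 h3]) _ Metric.isOpen_ball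
      (Metric.mem_ball_self (by positivity))
  obtain ⟨z, ⟨hzb, hz⟩, hd⟩ :=
    hdense.inter_open_nonempty _ (Metric.isOpen_ball.inter isOpen_interior) hne
  have hzV := interior_subset hz
  replace hd := hd hzV
  have hm := le_sideHull (tangent_mem_sideMinorants hu (fun _ _ _ ↦ le_rfl) hz hd) hw
  have hlip := hu.lipschitzOnWith.dist_le_mul z hzV w hw
  rw [Real.dist_eq, NNReal.coe_ofNat] at hlip
  have hx := hu.pd1_mem_Icc hz hd
  have hy := hu.pd2_mem_Icc hz hd
  have hdx : |z.1 - w.1| ≤ dist z w := by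
    rw [Prod.dist_eq, ← Real.dist_eq]; exact le_max_left _ _
  have hdy : |z.2 - w.2| ≤ dist z w := by
    rw [Prod.dist_eq, ← Real.dist_eq]; exact le_max_right _ _
  have hpx : pd1 u z * (z.1 - w.1) ≤ dist z w := by
    nlinarith [hx.1, hx.2, (abs_le.1 hdx).2, dist_nonneg (x := z) (y := w)]
  have hpy : pd2 u z * (z.2 - w.2) ≤ dist z w := by
    nlinarith [hy.1, hy.2, (abs_le.1 hdy).2, dist_nonneg (x := z) (y := w)]
  rw [tangent] at hm
  rw [Metric.mem_ball] at hzb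
  linarith [(abs_le.1 hlip).1]

lemma mem_interior_of_differentiableAt_sideHull (hu : Feasible xA xB yA yC u) {z : ℝ × ℝ}
    (hz : z ∈ V xA xB yA yC) (hd : DifferentiableAt ℝ (sideHull xA xB yA yC u) z) :
    z ∈ interior (V xA xB yA yC) := by
  rw [mem_interior_iff_mem_nhds]
  have hpos := (feasible_sideHull hu).1 z hz
  filter_upwards [hd.continuousAt.eventually_const_lt (show (-1 : ℝ) < _ by linarith)] with w hw
  by_contra h
  rw [sideHull, if_neg h] at hw
  exact lt_irrefl _ hw

/-- An affine minorant touching `u` at a point of differentiability is the tangent. -/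
lemma Feasible.pd_eq_of_touch {m : ℝ × ℝ → ℝ} {p q c : ℝ}
    (hm : ∀ z, m z = p * z.1 + q * z.2 + c) (hmu : ∀ z ∈ V xA xB yA yC, m z ≤ u z) {z : ℝ × ℝ}
    (hz : z ∈ interior (V xA xB yA yC)) (hd : DifferentiableAt ℝ u z) (htouch : u z ≤ m z) :
    pd1 u z = p ∧ pd2 u z = q := by
  let L : ℝ × ℝ →L[ℝ] ℝ := p • ContinuousLinearMap.fst ℝ ℝ ℝ + q • ContinuousLinearMap.snd ℝ ℝ ℝ
  have hmin : IsLocalMin (fun w ↦ u w - L w) z := by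
    filter_upwards [mem_interior_iff_mem_nhds.1 hz] with w hw
    have := hmu w hw
    rw [hm] at this htouch
    simp only [L, add_apply, smul_apply, ContinuousLinearMap.coe_fst',
      ContinuousLinearMap.coe_snd', smul_eq_mul]
    linarith
  have h := hmin.fderiv_eq_zero
  rw [fderiv_fun_sub hd L.differentiableAt, L.fderiv, sub_eq_zero] at h
  constructor
  · simp [pd1, h, L]
  · simp [pd2, h, L]

lemma Feasible.pay_le_of_pd_le (h0 : 0 ≤ xA) (h2 : 0 ≤ yA) (hu : Feasible xA xB yA yC u)
    {z w : ℝ × ℝ} (hz : z ∈ V xA xB yA yC) (hw : w ∈ V xA xB yA yC)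
    (hd : DifferentiableAt ℝ u w) (h1 : pd1 u z ≤ pd1 u w)
    (h2' : pd2 u z ≤ pd2 u w) : pay u z ≤ pay u w := by
  have h := hu.tangent_le hw hz hd
  have hz := mem_V.1 hz
  have hx := mul_le_mul_of_nonneg_right h1 (h0.trans hz.1.1)
  have hy := mul_le_mul_of_nonneg_right h2' (h2.trans hz.1.2)
  rw [pay, pay]
  linarith

/-- Along a horizontal move both slopes of `sideHull` increase: otherwise one could combine
the first slope at the right point with the second slope at the left point. -/
lemma pd_sideHull_mono_horizontal (hu : Feasible xA xB yA yC u) {x x' y : ℝ} (hx : x < x')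
    (hz : (x, y) ∈ V xA xB yA yC) (hw : (x', y) ∈ V xA xB yA yC)
    (hdz : DifferentiableAt ℝ (sideHull xA xB yA yC u) (x, y))
    (hdw : DifferentiableAt ℝ (sideHull xA xB yA yC u) (x', y)) :
    pd1 (sideHull xA xB yA yC u) (x, y) ≤ pd1 (sideHull xA xB yA yC u) (x', y) ∧
    pd2 (sideHull xA xB yA yC u) (x, y) ≤ pd2 (sideHull xA xB yA yC u) (x', y) := by
  have hzi := mem_interior_of_differentiableAt_sideHull hu hz hdz
  have hwi := mem_interior_of_differentiableAt_sideHull hu hw hdw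
  have hv := feasible_sideHull hu
  have hside := sideHull_le_of_side hu
  have hle {m : ℝ × ℝ → ℝ} (hm : m ∈ sideMinorants xA xB yA yC u) {z : ℝ × ℝ}
    (hz : z ∈ V xA xB yA yC) := le_sideHull hm hz
  set v := sideHull xA xB yA yC u
  have hmz := tangent_mem_sideMinorants hv hside hzi hdz
  have hmw := tangent_mem_sideMinorants hv hside hwi hdw
  have hzw := hv.tangent_le hz hw hdz
  have hwz := hv.tangent_le hw hz hdw
  have hp := hv.pd1_mem_Icc hwi hdw
  have hq := hv.pd2_mem_Icc hzi hdz
  rw [interior_V] at hzi hwi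
  obtain ⟨⟨hx1, -⟩, hy1, -⟩ := hzi
  simp only [sub_self, mul_zero, add_zero] at hzw hwz hx1 hy1
  have hmono : pd1 v (x, y) ≤ pd1 v (x', y) := by nlinarith
  refine ⟨hmono, ?_⟩
  by_contra! hlt
  set p := pd1 v (x, y)
  set q := pd2 v (x, y)
  set p' := pd1 v (x', y)
  set q' := pd2 v (x', y)
  -- the two candidate constants keep `m` below the tangents on the left and bottom sides
  set a := v (x, y) - p * (x - xA) - q * y - p' * xA
  set b := v (x', y) - p' * x' - q' * (y - yA) - q * yA
  let m : ℝ × ℝ → ℝ := fun z ↦ p' * z.1 + q * z.2 + min a b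
  have hm : m ∈ sideMinorants xA xB yA yC u := by
    refine ⟨⟨p', hp, q, hq, min a b, fun _ ↦ rfl⟩, fun s hs hL ↦ ?_⟩
    rcases hL with hL | hL
    · refine le_trans ?_ (hmz.2 s hs (.inl hL))
      have := min_le_left a b
      simp only [m, tangent, hL]
      linarith
    · refine le_trans ?_ (hmw.2 s hs (.inr hL))
      have := min_le_right a b
      simp only [m, tangent, hL]
      linarith
  have h1 := hle hm hz
  have h2 := hle hm hw
  rcases le_total a b with hab | hab
  · simp only [m, min_eq_left hab] at h1
    have hpp : p' = p := le_antisymm (by nlinarith) hmono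
    have htouch : v (x', y) ≤ tangent v (x, y) (x', y) := by
      simp only [tangent]
      rw [hpp] at hwz
      linarith
    have := (Feasible.pd_eq_of_touch (m := tangent v (x, y)) (p := p) (q := q)
      (c := v (x, y) - p * x - q * y) (fun s ↦ by simp only [tangent]; ring)
      (fun s hs ↦ hle hmz hs)
      (mem_interior_of_differentiableAt_sideHull hu hw hdw) hdw htouch).2
    exact hlt.ne this
  · simp only [m, min_eq_right hab] at h2
    nlinarith

lemma pd_sideHull_mono_vertical (hu : Feasible xA xB yA yC u) {x y y' : ℝ} (hy : y < y')
    (hz : (x, y) ∈ V xA xB yA yC) (hw : (x, y') ∈ V xA xB yA yC)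
    (hdz : DifferentiableAt ℝ (sideHull xA xB yA yC u) (x, y))
    (hdw : DifferentiableAt ℝ (sideHull xA xB yA yC u) (x, y')) :
    pd1 (sideHull xA xB yA yC u) (x, y) ≤ pd1 (sideHull xA xB yA yC u) (x, y') ∧
    pd2 (sideHull xA xB yA yC u) (x, y) ≤ pd2 (sideHull xA xB yA yC u) (x, y') := by
  have hzi := mem_interior_of_differentiableAt_sideHull hu hz hdz
  have hwi := mem_interior_of_differentiableAt_sideHull hu hw hdw
  have hv := feasible_sideHull hu
  have hside := sideHull_le_of_side hu
  have hle {m : ℝ × ℝ → ℝ} (hm : m ∈ sideMinorants xA xB yA yC u) {z : ℝ × ℝ}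
    (hz : z ∈ V xA xB yA yC) := le_sideHull hm hz
  set v := sideHull xA xB yA yC u
  have hmz := tangent_mem_sideMinorants hv hside hzi hdz
  have hmw := tangent_mem_sideMinorants hv hside hwi hdw
  have hzw := hv.tangent_le hz hw hdz
  have hwz := hv.tangent_le hw hz hdw
  have hp := hv.pd1_mem_Icc hzi hdz
  have hq := hv.pd2_mem_Icc hwi hdw
  rw [interior_V] at hzi hwi
  obtain ⟨⟨hx1, -⟩, hy1, -⟩ := hzi
  simp only [sub_self, mul_zero, zero_add] at hzw hwz hx1 hy1
  have hmono : pd2 v (x, y) ≤ pd2 v (x, y') := by nlinarith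
  refine ⟨?_, hmono⟩
  by_contra! hlt
  set p := pd1 v (x, y)
  set q := pd2 v (x, y)
  set p' := pd1 v (x, y')
  set q' := pd2 v (x, y')
  set a := v (x, y) - q * (y - yA) - p * x - q' * yA
  set b := v (x, y') - q' * y' - p' * (x - xA) - p * xA
  let m : ℝ × ℝ → ℝ := fun z ↦ p * z.1 + q' * z.2 + min a b
  have hm : m ∈ sideMinorants xA xB yA yC u := by
    refine ⟨⟨p, hp, q', hq, min a b, fun _ ↦ rfl⟩, fun s hs hL ↦ ?_⟩
    rcases hL with hL | hL
    · refine le_trans ?_ (hmw.2 s hs (.inl hL))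
      have := min_le_right a b
      simp only [m, tangent, hL]
      linarith
    · refine le_trans ?_ (hmz.2 s hs (.inr hL))
      have := min_le_left a b
      simp only [m, tangent, hL]
      linarith
  have h1 := hle hm hz
  have h2 := hle hm hw
  rcases le_total a b with hab | hab
  · simp only [m, min_eq_left hab] at h1
    have hqq : q' = q := le_antisymm (by nlinarith) hmono
    have htouch : v (x, y') ≤ tangent v (x, y) (x, y') := by
      simp only [tangent]
      rw [hqq] at hwz
      linarith
    have := (Feasible.pd_eq_of_touch (m := tangent v (x, y)) (p := p) (q := q)
      (c := v (x, y) - p * x - q * y) (fun s ↦ by simp only [tangent]; ring)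
      (fun s hs ↦ hle hmz hs)
      (mem_interior_of_differentiableAt_sideHull hu hw hdw) hdw htouch).1
    exact hlt.ne this
  · simp only [m, min_eq_right hab] at h2
    nlinarith

end MaximalUtility

/-- under Condition 1 there is an optimal feasible utility whose payment
function is weakly increasing in each coordinate. -/
theorem stmt5 (xA xB yA yC : ℝ) (h0 : 0 ≤ xA) (h1 : xA < xB) (h2 : 0 ≤ yA) (h3 : yA < yC)
    (f1 f2 : ℝ → ℝ) (hf1 : Density xA xB f1) (hf2 : Density yA yC f2)
    (hC1 : ∀ x ∈ Set.Icc xA xB, ∀ y ∈ Set.Icc yA yC, PR f1 x + PR f2 y ≤ -3) :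
    ∃ u : ℝ × ℝ → ℝ, Optimal xA xB yA yC f1 f2 u ∧
      ∀ x y x' y' : ℝ, (x, y) ∈ V xA xB yA yC → (x', y') ∈ V xA xB yA yC →
        DifferentiableAt ℝ u (x, y) → DifferentiableAt ℝ u (x', y') →
        ((x ≤ x' ∧ y = y') ∨ (x = x' ∧ y ≤ y')) →
        pay u (x, y) ≤ pay u (x', y') := by
  obtain ⟨u, hu, hopt⟩ := exists_optimal h1.le h3.le hf1 hf2
  have hv := feasible_sideHull hu
  have hside := sideHull_le_of_side hu
  have hge : ∀ z ∈ V xA xB yA yC, u z ≤ sideHull xA xB yA yC u z :=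
    fun z hz ↦ le_sideHull_self h1 h3 hu hz
  refine ⟨sideHull xA xB yA yC u, ⟨hv, (hv.rev_le_optRev hf1 hf2).antisymm ?_⟩, ?_⟩
  · rw [← hopt]
    exact rev_mono h0 h2 hf1 hf2 hC1 hu hv hge
      fun z hz hL ↦ (hge z hz).antisymm (hside z hz hL)
  · rintro x y x' y' hz hw hdz hdw (⟨hx, rfl⟩ | ⟨rfl, hy⟩)
    · rcases hx.eq_or_lt with rfl | hx
      · exact le_rfl
      · obtain ⟨hp, hq⟩ := pd_sideHull_mono_horizontal hu hx hz hw hdz hdw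
        exact hv.pay_le_of_pd_le h0 h2 hz hw hdw hp hq
    · rcases hy.eq_or_lt with rfl | hy
      · exact le_rfl
      · obtain ⟨hp, hq⟩ := pd_sideHull_mono_vertical hu hy hz hw hdz hdw
        exact hv.pay_le_of_pd_le h0 h2 hz hw hdw hp hq
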